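/- Let ϑ > 0, γ̃ ∈ (0, 1/2), and let g : [0,∞)×[0,1] → ℝ be continuous with g(s,0) = g(s,1) = 0 for all s and with sup_{s,x} |g(s,x)| ≤ B and |g(s,x) − g(s,y)| ≤ B·|x − y|^{γ̃} for all s ≥ 0 and x, y ∈ [0,1]. Let α ∈ (0,1) and β ∈ (0,1] satisfy α + β < 1 + γ̃. Then there exists a constant C > 0, depending only on α, β, γ̃ and ϑ, such that for all t ≥ 0, Δ ∈ (0,1], δ ∈ (0,1] and y ∈ [0,1] with y + δ ≤ 1, the double (space-time) increment of N satisfies |N(t+Δ, y+δ) − N(t+Δ, y) − N(t, y+δ) + N(t, y)| ≤ C·B·δ^α·Δ^{(1+β)/2}. -/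

import Mathlib

open Real MeasureTheory

/-- The sine basis functions `e_ℓ(x) = √2 sin(πℓx)`. -/
noncomputable def sineB (ℓ : ℕ) (x : ℝ) : ℝ := Real.sqrt 2 * Real.sin (Real.pi * ℓ * x)

/-- Fourier sine coefficients `c_ℓ(s) = ∫₀¹ g(s,y) e_ℓ(y) dy`. -/
noncomputable def fCoef (g : ℝ → ℝ → ℝ) (ℓ : ℕ) (s : ℝ) : ℝ :=
  ∫ y in (0 : ℝ)..1, g s y * sineB ℓ y

/-- The heat convolution `N(t,x) = ∫₀ᵗ ∑_{ℓ≥1} e^{−λ_ℓ(t−s)} c_ℓ(s) e_ℓ(x) ds`,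
where `λ_ℓ = ϑπ²ℓ²`. -/
noncomputable def heatConv (ϑ : ℝ) (g : ℝ → ℝ → ℝ) (t x : ℝ) : ℝ :=
  ∫ s in (0 : ℝ)..t,
    ∑' ℓ : ℕ, Real.exp (-(ϑ * Real.pi ^ 2 * ((ℓ : ℝ) + 1) ^ 2 * (t - s)))
      * fCoef g (ℓ + 1) s * sineB (ℓ + 1) x


open ProbabilityTheory in
/-- Heat semigroup on the real line, indexed by variance. -/
noncomputable def hP (v : ℝ) (f : ℝ → ℝ) (x : ℝ) : ℝ :=
  ∫ y, f (x + y) ∂(gaussianReal 0 v.toNNReal)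

open ProbabilityTheory

lemma hP_int {f : ℝ → ℝ} (hf : Continuous f) {K : ℝ} (hK : ∀ x, |f x| ≤ K) (v x : ℝ) :
    Integrable (fun y => f (x + y)) (gaussianReal 0 v.toNNReal) :=
  Integrable.of_bound (by fun_prop) K (Filter.Eventually.of_forall fun y => hK _)

lemma hP_bound {f : ℝ → ℝ} {K : ℝ} (hK : ∀ x, |f x| ≤ K) (v x : ℝ) :
    |hP v f x| ≤ K := by
  have := norm_integral_le_of_norm_le_const (μ := gaussianReal 0 v.toNNReal)
    (f := fun y => f (x + y)) (C := K) (Filter.Eventually.of_forall fun y => hK _)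
  simpa [hP] using this

lemma hP_cont {f : ℝ → ℝ} (hf : Continuous f) {K : ℝ} (hK : ∀ x, |f x| ≤ K) (v : ℝ) :
    Continuous (hP v f) := by
  unfold hP
  refine continuous_of_dominated (bound := fun _ => K) ?_ ?_ ?_ ?_
  · intro x; exact (hP_int hf hK v x).aestronglyMeasurable
  · intro x; exact Filter.Eventually.of_forall fun y => hK _
  · exact integrable_const _
  · exact Filter.Eventually.of_forall fun y => by fun_prop

lemma hP_sub {f g : ℝ → ℝ} (hf : Continuous f) {K : ℝ} (hK : ∀ x, |f x| ≤ K)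
    (hg : Continuous g) {L : ℝ} (hL : ∀ x, |g x| ≤ L) (v x : ℝ) :
    hP v (fun z => f z - g z) x = hP v f x - hP v g x := by
  unfold hP
  exact integral_sub (hP_int hf hK v x) (hP_int hg hL v x)

lemma hP_shift {f : ℝ → ℝ} (v a x : ℝ) :
    hP v (fun z => f (z + a)) x = hP v f (x + a) := by
  unfold hP
  refine integral_congr_ae (.of_forall fun y => ?_)
  change f (x + y + a) = f (x + a + y)
  rw [add_right_comm]

lemma hP_semi {f : ℝ → ℝ} (hf : Continuous f) {K : ℝ} (hK : ∀ x, |f x| ≤ K) {a b : ℝ}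
    (ha : 0 ≤ a) (hb : 0 ≤ b) (x : ℝ) : hP a (hP b f) x = hP (a + b) f x := by
  unfold hP
  have h := hP_int hf hK (a + b) x
  rw [Real.toNNReal_add ha hb, show (0:ℝ) = 0 + 0 by simp, ← gaussianReal_conv_gaussianReal] at h ⊢
  rw [integral_conv h]
  simp [add_assoc]

lemma hP_tilt {f : ℝ → ℝ} {v : ℝ} (hv : 0 < v) (x a : ℝ) :
    hP v f (x + a) = ∫ y, Real.exp (a * y / v - a ^ 2 / (2 * v)) * f (x + y)
      ∂(gaussianReal 0 v.toNNReal) := by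
  have hv' : v.toNNReal ≠ 0 := by simpa using hv
  have h1 : hP v f (x + a) = ∫ y, f (x + y) ∂(gaussianReal a v.toNNReal) := by
    have h := gaussianReal_map_const_add (μ := 0) (v := v.toNNReal) a
    rw [zero_add] at h
    rw [← h, (measurableEmbedding_addLeft a).integral_map]
    unfold hP
    simp [add_assoc]
  rw [h1, integral_gaussianReal_eq_integral_smul hv', integral_gaussianReal_eq_integral_smul hv']
  congr 1; ext y
  simp only [gaussianPDFReal, smul_eq_mul, Real.coe_toNNReal v hv.le]
  rw [show -(y - a) ^ 2 / (2 * v) = -(y - 0) ^ 2 / (2 * v) + (a * y / v - a ^ 2 / (2 * v)) by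
    field_simp; ring, Real.exp_add]
  ring

lemma gauss_sq {v : ℝ} (hv : 0 ≤ v) :
    Integrable (fun y : ℝ => y ^ 2) (gaussianReal 0 v.toNNReal) ∧
    ∫ y, y ^ 2 ∂(gaussianReal 0 v.toNNReal) = v := by
  constructor
  · exact (memLp_id_gaussianReal (μ := 0) (v := v.toNNReal) 2).integrable_sq
  · have h := variance_fun_id_gaussianReal (μ := 0) (v := v.toNNReal)
    rw [variance_eq_integral measurable_id'.aemeasurable] at h
    simpa [hv] using h

lemma gauss_w {v : ℝ} (hv : 0 < v) (a : ℝ) :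
    Integrable (fun y : ℝ => Real.exp (a * y / v - a ^ 2 / (2 * v)))
      (gaussianReal 0 v.toNNReal) ∧
    ∫ y, Real.exp (a * y / v - a ^ 2 / (2 * v)) ∂(gaussianReal 0 v.toNNReal) = 1 := by
  have e : (fun y : ℝ => Real.exp (a * y / v - a ^ 2 / (2 * v))) =
    fun y => Real.exp (- (a ^ 2 / (2 * v))) * Real.exp ((a / v) * y) := by
    ext y; rw [← Real.exp_add]; congr 1; ring
  rw [e]
  constructor
  · exact (integrable_exp_mul_gaussianReal _).const_mul _
  · rw [integral_const_mul]
    have := congrFun (mgf_fun_id_gaussianReal (μ := 0) (v := v.toNNReal)) (a / v)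
    unfold mgf at this
    rw [this, ← Real.exp_add, Real.coe_toNNReal v hv.le, Real.exp_eq_one_iff]
    field_simp; ring

lemma gauss_w2 {v : ℝ} (hv : 0 < v) (a : ℝ) :
    Integrable (fun y : ℝ => (Real.exp (a * y / v - a ^ 2 / (2 * v)) - 1) ^ 2)
      (gaussianReal 0 v.toNNReal) ∧
    ∫ y, (Real.exp (a * y / v - a ^ 2 / (2 * v)) - 1) ^ 2 ∂(gaussianReal 0 v.toNNReal)
      = Real.exp (a ^ 2 / v) - 1 := by
  have e : (fun y : ℝ => (Real.exp (a * y / v - a ^ 2 / (2 * v)) - 1) ^ 2) =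
    fun y => Real.exp (a ^ 2 / v) * Real.exp ((2 * a) * y / v - (2 * a) ^ 2 / (2 * v))
      - 2 * Real.exp (a * y / v - a ^ 2 / (2 * v)) + 1 := by
    ext y
    rw [sub_sq, ← Real.exp_nat_mul, ← Real.exp_add]
    have : a ^ 2 / v + ((2 * a) * y / v - (2 * a) ^ 2 / (2 * v)) =
      (2 : ℕ) * (a * y / v - a ^ 2 / (2 * v)) := by push_cast; field_simp; ring
    rw [this]; ring
  rw [e]
  obtain ⟨i1, h1⟩ := gauss_w hv a
  obtain ⟨i2, h2⟩ := gauss_w hv (2 * a)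
  have j1 := i1.const_mul 2
  have j2 := i2.const_mul (Real.exp (a ^ 2 / v))
  have j3 : Integrable (fun y : ℝ => Real.exp (a ^ 2 / v) *
      Real.exp ((2 * a) * y / v - (2 * a) ^ 2 / (2 * v))
      - 2 * Real.exp (a * y / v - a ^ 2 / (2 * v))) (gaussianReal 0 v.toNNReal) := j2.sub j1
  refine ⟨j3.add (integrable_const _), ?_⟩
  rw [integral_add j3 (integrable_const _), integral_sub j2 j1,
    integral_const_mul, integral_const_mul, h1, h2]
  simp; ring

lemma rpow_sq_le {κ : ℝ} (h0 : 0 ≤ κ) (h1 : κ ≤ 1) {v : ℝ} (hv : 0 < v) (y : ℝ) :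
    (|y| ^ κ) ^ 2 ≤ v ^ κ * (1 + y ^ 2 / v) := by
  have h : (|y| ^ κ) ^ 2 = (v * (y ^ 2 / v)) ^ κ := by
    rw [← Real.rpow_natCast, ← Real.rpow_mul (abs_nonneg y), mul_comm, Real.rpow_mul (abs_nonneg y)]
    congr 1; field_simp; simp
  have hp : 0 ≤ y ^ 2 / v := by positivity
  rw [h, Real.mul_rpow hv.le hp]
  gcongr
  calc (y ^ 2 / v) ^ κ ≤ (1 + y ^ 2 / v) ^ κ := by gcongr; linarith
    _ ≤ (1 + y ^ 2 / v) ^ (1 : ℝ) := by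
        apply Real.rpow_le_rpow_of_exponent_le _ h1; linarith
    _ = _ := Real.rpow_one _

lemma hP_lip_loc {f : ℝ → ℝ} (hf : Continuous f) {K : ℝ} (hK : ∀ x, |f x| ≤ K)
    {κ M : ℝ} (h0 : 0 ≤ κ) (h1 : κ ≤ 1) (hM : 0 ≤ M)
    (hH : ∀ x y, |f (x + y) - f x| ≤ M * |y| ^ κ) {v : ℝ} (hv : 0 < v) (x a : ℝ)
    (hav : a ^ 2 ≤ v) :
    |hP v f (x + a) - hP v f x| ≤ 2 * M * |a| * v ^ ((κ - 1) / 2) := by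
  rcases hM.eq_or_lt with rfl | hM
  · have : ∀ x y, f (x + y) = f x := fun x y => by
      have := hH x y
      simp only [zero_mul, abs_nonpos_iff] at this
      linarith
    simp [hP, this]
  rcases eq_or_ne a 0 with rfl | ha
  · simp
  set γ := gaussianReal 0 v.toNNReal
  set u : ℝ → ℝ := fun y => f (x + y) - f x with hu
  set w : ℝ → ℝ := fun y => Real.exp (a * y / v - a ^ 2 / (2 * v)) - 1 with hw
  obtain ⟨iw, ew⟩ := gauss_w hv a
  obtain ⟨iw2, ew2⟩ := gauss_w2 hv a
  obtain ⟨iy, ey⟩ := gauss_sq hv.le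
  have hfi := hP_int hf hK v x
  have iu : Integrable u γ := hfi.sub (integrable_const _)
  have hcw : Continuous w := by fun_prop
  have iuw : Integrable (fun y => w y * u y) γ := by
    refine (iw.sub (integrable_const 1)).mul_bdd (c := K + K) (by fun_prop) ?_
    exact Filter.Eventually.of_forall fun y => (norm_sub_le _ _).trans (add_le_add (hK _) (hK _))
  have key : hP v f (x + a) - hP v f x = ∫ y, w y * u y ∂γ := by
    rw [hP_tilt hv, hP]
    have i1 : Integrable (fun y => Real.exp (a * y / v - a ^ 2 / (2 * v)) * f (x + y)) γ := by
      refine iw.mul_bdd (c := K) (by fun_prop) ?_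
      exact Filter.Eventually.of_forall fun y => hK _
    have : (fun y => w y * u y) = fun y =>
      (Real.exp (a * y / v - a ^ 2 / (2 * v)) * f (x + y) - f (x + y)) -
      (Real.exp (a * y / v - a ^ 2 / (2 * v)) * f x - f x) := by
      ext y; simp only [hu, hw]; ring
    have k1 : Integrable (fun y => Real.exp (a * y / v - a ^ 2 / (2 * v)) * f (x + y)
      - f (x + y)) γ := i1.sub hfi
    have k2 : Integrable (fun y => Real.exp (a * y / v - a ^ 2 / (2 * v)) * f x - f x) γ :=
      (iw.mul_const _).sub (integrable_const _)
    rw [this, integral_sub k1 k2,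
      integral_sub i1 hfi, integral_sub (iw.mul_const _) (integrable_const _), integral_mul_const, ew]
    simp [γ]
  rw [key]
  have ha' : 0 < |a| := abs_pos.mpr ha
  set l : ℝ := |a| / (M * v ^ ((κ + 1) / 2)) with hl
  have hlp : 0 < l := by positivity
  have bd : ∀ y, ‖w y * u y‖ ≤ (l / 2 * M ^ 2 * v ^ κ) * (1 + y ^ 2 / v) + (2 * l)⁻¹ * (w y) ^ 2 := by
    intro y
    have e1 : (u y) ^ 2 ≤ M ^ 2 * (v ^ κ * (1 + y ^ 2 / v)) := by
      calc (u y) ^ 2 = |u y| ^ 2 := (sq_abs _).symm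
        _ ≤ (M * |y| ^ κ) ^ 2 := by gcongr; exact hH x y
        _ = M ^ 2 * (|y| ^ κ) ^ 2 := by ring
        _ ≤ _ := by gcongr; exact rpow_sq_le h0 h1 hv y
    have e2 : |w y * u y| ≤ l / 2 * (u y) ^ 2 + (2 * l)⁻¹ * (w y) ^ 2 := by
      rw [abs_mul, ← sq_abs (u y), ← sq_abs (w y)]
      have : 0 ≤ (2 * l)⁻¹ * (|w y| - l * |u y|) ^ 2 := by positivity
      have h3 : (2 * l)⁻¹ * (|w y| - l * |u y|) ^ 2 =
        l / 2 * |u y| ^ 2 + (2 * l)⁻¹ * |w y| ^ 2 - |w y| * |u y| := by field_simp; ring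
      linarith
    calc ‖w y * u y‖ ≤ _ := e2
      _ ≤ l / 2 * (M ^ 2 * (v ^ κ * (1 + y ^ 2 / v))) + (2 * l)⁻¹ * (w y) ^ 2 := by gcongr
      _ = _ := by ring
  have ib1 : Integrable (fun y : ℝ => 1 + y ^ 2 / v) γ := (integrable_const _).add (iy.div_const v)
  have eb1 : ∫ y : ℝ, (1 + y ^ 2 / v) ∂γ = 2 := by
    rw [integral_add (integrable_const _) (iy.div_const v), integral_div, ey, div_self hv.ne']
    simp; norm_num
  have ib := (ib1.const_mul (l / 2 * M ^ 2 * v ^ κ)).add (iw2.const_mul (2 * l)⁻¹)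
  have hb := norm_integral_le_of_norm_le ib (Filter.Eventually.of_forall bd)
  have hexp : Real.exp (a ^ 2 / v) - 1 ≤ 2 * (a ^ 2 / v) := by
    have h2 : 0 ≤ a ^ 2 / v := by positivity
    have := Real.abs_exp_sub_one_le (x := a ^ 2 / v) (by
      rw [abs_of_nonneg h2]; exact (div_le_one hv).mpr hav)
    rw [abs_of_nonneg h2] at this
    exact (le_abs_self _).trans this
  rw [integral_add' (ib1.const_mul _) (iw2.const_mul _), integral_const_mul, integral_const_mul, eb1, ew2] at hb
  refine hb.trans ?_
  have e3 : l / 2 * M ^ 2 * v ^ κ * 2 = M * |a| * v ^ ((κ - 1) / 2) := by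
    have : v ^ κ = v ^ ((κ - 1) / 2) * v ^ ((κ + 1) / 2) := by
      rw [← Real.rpow_add hv]; congr 1; ring
    rw [this, hl]
    have : v ^ ((κ + 1) / 2) ≠ 0 := by positivity
    field_simp
  have e4 : (2 * l)⁻¹ * (2 * (a ^ 2 / v)) = M * |a| * v ^ ((κ - 1) / 2) := by
    have : v ^ ((κ + 1) / 2) = v ^ ((κ - 1) / 2) * v := by
      rw [← Real.rpow_add_one hv.ne']; congr 1; ring
    rw [hl, this, ← sq_abs a]
    have : v ^ ((κ - 1) / 2) ≠ 0 := by positivity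
    field_simp
  calc _ ≤ l / 2 * M ^ 2 * v ^ κ * 2 + (2 * l)⁻¹ * (2 * (a ^ 2 / v)) := by gcongr
    _ = _ := by rw [e3, e4]; ring

lemma hP_lip {f : ℝ → ℝ} (hf : Continuous f) {K : ℝ} (hK : ∀ x, |f x| ≤ K)
    {κ M : ℝ} (h0 : 0 ≤ κ) (h1 : κ ≤ 1) (hM : 0 ≤ M)
    (hH : ∀ x y, |f (x + y) - f x| ≤ M * |y| ^ κ) {v : ℝ} (hv : 0 < v) (x a : ℝ) :
    |hP v f (x + a) - hP v f x| ≤ 2 * M * |a| * v ^ ((κ - 1) / 2) := by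
  obtain ⟨n, hn⟩ := exists_nat_gt (|a| / √v)
  have hsv : 0 < √v := Real.sqrt_pos.mpr hv
  have hn0 : (0 : ℝ) < n := lt_of_le_of_lt (by positivity) hn
  have hb : (a / n) ^ 2 ≤ v := by
    rw [← Real.sq_sqrt hv.le, sq_le_sq, abs_of_pos hsv, abs_div, abs_of_pos hn0]
    rw [div_lt_iff₀ hsv] at hn
    rw [div_le_iff₀ hn0]; linarith
  have ind : ∀ m : ℕ, |hP v f (x + m * (a / n)) - hP v f x| ≤
      m * (2 * M * |a / n| * v ^ ((κ - 1) / 2)) := by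
    intro m
    induction m with
    | zero => simp
    | succ k ih =>
      have := hP_lip_loc hf hK h0 h1 hM hH hv (x + k * (a / n)) (a / n) hb
      have e : x + ((k + 1 : ℕ) : ℝ) * (a / n) = x + k * (a / n) + a / n := by push_cast; ring
      rw [e]
      calc _ ≤ |hP v f (x + k * (a / n) + a / n) - hP v f (x + k * (a / n))| +
            |hP v f (x + k * (a / n)) - hP v f x| := abs_sub_le _ _ _
        _ ≤ _ := by push_cast; linarith
  have := ind n
  rw [mul_div_cancel₀ _ hn0.ne', abs_div, abs_of_pos hn0] at this
  refine this.trans (le_of_eq ?_)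
  field_simp

lemma half_rpow {v e c : ℝ} (hv : 0 < v) (he : -c ≤ e) :
    (v / 2) ^ e ≤ 2 ^ c * v ^ e := by
  rw [div_eq_mul_inv, Real.mul_rpow hv.le (by norm_num), Real.inv_rpow (by norm_num),
    ← Real.rpow_neg (by norm_num), mul_comm]
  gcongr
  · norm_num
  · linarith

lemma hP_second {f : ℝ → ℝ} (hf : Continuous f) {K : ℝ} (hK : ∀ x, |f x| ≤ K)
    {κ M : ℝ} (h0 : 0 ≤ κ) (h1 : κ ≤ 1) (hM : 0 ≤ M)
    (hH : ∀ x y, |f (x + y) - f x| ≤ M * |y| ^ κ) {v : ℝ} (hv : 0 < v) (x y : ℝ) :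
    |hP v f (x + y) + hP v f (x - y) - 2 * hP v f x| ≤ 16 * M * v ^ (κ / 2 - 1) * y ^ 2 := by
  have hv2 : 0 < v / 2 := by positivity
  have hkc := hP_cont hf hK (v / 2)
  have hkb := hP_bound hK (v / 2)
  set k := hP (v / 2) f with hk
  have hsemi : ∀ z, hP (v / 2) k z = hP v f z := fun z => by
    rw [hk, hP_semi hf hK hv2.le hv2.le]; congr 1; ring
  set A := 2 * M * |y| * (v / 2) ^ ((κ - 1) / 2) with hA
  have hA0 : 0 ≤ A := by positivity
  have hDb : ∀ z, |k (z + y) - k z| ≤ A := fun z => hP_lip hf hK h0 h1 hM hH hv2 z y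
  have hD : ∀ z, hP (v / 2) (fun z => k (z + y) - k z) z = hP v f (z + y) - hP v f z := by
    intro z
    rw [hP_sub (f := fun z => k (z + y)) (by fun_prop) (fun z => hkb (z + y)) hkc hkb, hP_shift,
      hsemi, hsemi]
  have h := hP_lip (f := fun z => k (z + y) - k z) (by fun_prop) hDb (κ := 0) (M := 2 * A) le_rfl
    zero_le_one (by positivity)
    (fun z a => by
      rw [Real.rpow_zero, mul_one, two_mul]
      exact (abs_sub _ _).trans (add_le_add (hDb _) (hDb _))) hv2 (x - y) y
  rw [hD, hD] at h
  have e : hP v f (x + y) + hP v f (x - y) - 2 * hP v f x =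
    hP v f (x - y + y + y) - hP v f (x - y + y) - (hP v f (x - y + y) - hP v f (x - y)) := by
    rw [sub_add_cancel]; ring
  rw [e]
  refine h.trans ?_
  have e2 : (v / 2) ^ ((κ - 1) / 2) * (v / 2) ^ ((0 - 1 : ℝ) / 2) = (v / 2) ^ (κ / 2 - 1) := by
    rw [← Real.rpow_add hv2]; congr 1; ring
  have e3 := half_rpow (e := κ / 2 - 1) (c := 1) hv (by linarith)
  rw [Real.rpow_one] at e3
  calc _ = 8 * M * |y| ^ 2 * ((v / 2) ^ ((κ - 1) / 2) * (v / 2) ^ ((0 - 1 : ℝ) / 2)) := by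
        rw [hA]; ring
    _ = 8 * M * y ^ 2 * (v / 2) ^ (κ / 2 - 1) := by rw [e2, sq_abs]
    _ ≤ 8 * M * y ^ 2 * (2 * v ^ (κ / 2 - 1)) := by gcongr
    _ = _ := by ring

lemma hP_time {f : ℝ → ℝ} (hf : Continuous f) {K : ℝ} (hK : ∀ x, |f x| ≤ K)
    {κ M : ℝ} (h0 : 0 ≤ κ) (h1 : κ ≤ 1) (hM : 0 ≤ M)
    (hH : ∀ x y, |f (x + y) - f x| ≤ M * |y| ^ κ) {v h : ℝ} (hv : 0 < v) (hh : 0 ≤ h) (x : ℝ) :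
    |hP (v + h) f x - hP v f x| ≤ 8 * M * v ^ (κ / 2 - 1) * h := by
  set k := hP v f with hk
  have hkc : Continuous k := hP_cont hf hK v
  have hkb := hP_bound hK v
  obtain ⟨iy, ey⟩ := gauss_sq hh
  have e1 : hP (v + h) f x = hP h k x := by
    rw [hk, hP_semi hf hK hh hv.le, add_comm]
  have e2 : hP h k x = ∫ y, k (x - y) ∂(gaussianReal 0 h.toNNReal) := by
    have hm := gaussianReal_map_neg (μ := 0) (v := h.toNNReal)
    rw [neg_zero] at hm
    unfold hP
    conv_lhs => rw [← hm]
    rw [integral_map (by fun_prop) (by fun_prop)]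
    simp [sub_eq_add_neg]
  have i1 := hP_int hkc hkb h x
  have i2 : Integrable (fun y => k (x - y)) (gaussianReal 0 h.toNNReal) :=
    Integrable.of_bound (by fun_prop) K (Filter.Eventually.of_forall fun y => hkb _)
  have e3 : 2 * (hP h k x - k x) = ∫ y, (k (x + y) + k (x - y) - 2 * k x)
      ∂(gaussianReal 0 h.toNNReal) := by
    have i3 : Integrable (fun y => k (x + y) + k (x - y)) (gaussianReal 0 h.toNNReal) := i1.add i2
    rw [integral_sub i3 (integrable_const _), integral_add i1 i2, ← e2]
    simp [hP]; ring
  have hb := norm_integral_le_of_norm_le (f := fun y => k (x + y) + k (x - y) - 2 * k x)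
    (iy.const_mul (16 * M * v ^ (κ / 2 - 1)))
    (Filter.Eventually.of_forall fun y => hP_second hf hK h0 h1 hM hH hv x y)
  rw [← e3, integral_const_mul, ey, Real.norm_eq_abs, abs_mul, abs_two] at hb
  rw [e1]; linarith

lemma hP_double {f : ℝ → ℝ} (hf : Continuous f) {K : ℝ} (hK : ∀ x, |f x| ≤ K)
    {κ M : ℝ} (h0 : 0 ≤ κ) (h1 : κ ≤ 1) (hM : 0 ≤ M)
    (hH : ∀ x y, |f (x + y) - f x| ≤ M * |y| ^ κ) {v h : ℝ} (hv : 0 < v) (hh : 0 ≤ h) (x a : ℝ) :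
    |(hP (v + h) f (x + a) - hP v f (x + a)) - (hP (v + h) f x - hP v f x)|
      ≤ 128 * M * v ^ (κ / 2 - 1) * h * (|a| * v ^ (-(1 / 2) : ℝ)) := by
  have hv2 : 0 < v / 2 := by positivity
  set q : ℝ → ℝ := fun z => hP (v / 2 + h) f z - hP (v / 2) f z with hq
  have c1 := hP_cont hf hK (v / 2 + h)
  have c2 := hP_cont hf hK (v / 2)
  have b1 := hP_bound hK (v / 2 + h)
  have b2 := hP_bound hK (v / 2)
  set A := 8 * M * (v / 2) ^ (κ / 2 - 1) * h with hA
  have hA0 : 0 ≤ A := by positivity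
  have hqb : ∀ z, |q z| ≤ A := fun z => hP_time hf hK h0 h1 hM hH hv2 hh z
  have hPq : ∀ z, hP (v / 2) q z = hP (v + h) f z - hP v f z := by
    intro z
    rw [hq, hP_sub c1 b1 c2 b2, hP_semi hf hK hv2.le (by positivity),
      hP_semi hf hK hv2.le hv2.le]
    congr 2 <;> ring
  have hl := hP_lip (f := q) (by fun_prop) hqb (κ := 0) (M := 2 * A) le_rfl
    zero_le_one (by positivity)
    (fun z a => by
      rw [Real.rpow_zero, mul_one, two_mul]
      exact (abs_sub _ _).trans (add_le_add (hqb _) (hqb _))) hv2 x a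
  rw [hPq, hPq] at hl
  refine hl.trans ?_
  have e3 := half_rpow (e := κ / 2 - 1) (c := 1) hv (by linarith)
  have e4 := half_rpow (e := (0 - 1 : ℝ) / 2) (c := 1) hv (by norm_num)
  rw [Real.rpow_one] at e3 e4
  calc _ = 32 * M * (v / 2) ^ (κ / 2 - 1) * h * (|a| * (v / 2) ^ ((0 - 1 : ℝ) / 2)) := by
        rw [hA]; ring
    _ ≤ 32 * M * (2 * v ^ (κ / 2 - 1)) * h * (|a| * (2 * v ^ ((0 - 1 : ℝ) / 2))) := by gcongr
    _ = _ := by rw [show (0 - 1 : ℝ) / 2 = -(1 / 2) by norm_num]; ring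

lemma fou_two (n : ℤ) (x : ℝ) : (fourier n (x : AddCircle (2 : ℝ)) : ℂ) =
    Complex.exp (((π * n : ℝ) : ℂ) * x * Complex.I) := by
  rw [fourier_coe_apply]
  congr 1; push_cast; ring

lemma odd_coef {F : ℝ → ℝ} (hF : Continuous F) (hodd : ∀ x, F (-x) = -F x) (n : ℤ) :
    ∫ x in (-1 : ℝ)..1, Complex.exp (((π * (-n : ℤ) : ℝ) : ℂ) * x * Complex.I) * (F x : ℂ) =
      -2 * Complex.I * ((∫ x in (0 : ℝ)..1, F x * Real.sin (π * n * x) : ℝ) : ℂ) := by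
  set φ : ℝ → ℂ := fun x => Complex.exp (((π * (-n : ℤ) : ℝ) : ℂ) * x * Complex.I) * (F x : ℂ)
    with hφ
  have hc : Continuous φ := by fun_prop
  have h1 : ∫ x in (-1 : ℝ)..0, φ x = ∫ x in (0 : ℝ)..1, φ (-x) := by
    rw [intervalIntegral.integral_comp_neg]; simp
  have hc' : Continuous fun x => φ (-x) := by fun_prop
  rw [← intervalIntegral.integral_add_adjacent_intervals (b := 0) (hc.intervalIntegrable _ _)
    (hc.intervalIntegrable _ _), h1, ← intervalIntegral.integral_add (hc'.intervalIntegrable _ _)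
    (hc.intervalIntegrable _ _), ← intervalIntegral.integral_ofReal,
    ← intervalIntegral.integral_const_mul]
  congr 1; ext x
  simp only [hφ, hodd]
  push_cast
  have e1 : (π : ℂ) * -(n : ℂ) * -(x : ℂ) * Complex.I = (π * n * x : ℂ) * Complex.I := by ring
  have e2 : (π : ℂ) * -(n : ℂ) * (x : ℂ) * Complex.I = (-(π * n * x) : ℂ) * Complex.I := by ring
  rw [e1, e2, Complex.exp_mul_I, Complex.exp_mul_I, Complex.cos_neg, Complex.sin_neg]
  ring

lemma hP_coef {F : ℝ → ℝ} (hF : Continuous F) {K : ℝ} (hK : ∀ x, |F x| ≤ K)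
    (hper : ∀ x, F (x + 2) = F x) {v : ℝ} (hv : 0 ≤ v) (n : ℤ) :
    ∫ x in (-1 : ℝ)..1, Complex.exp (((π * (-n : ℤ) : ℝ) : ℂ) * x * Complex.I) * (hP v F x : ℂ) =
      (Real.exp (-(v * (π * n) ^ 2 / 2)) : ℂ) *
    ∫ x in (-1 : ℝ)..1, Complex.exp (((π * (-n : ℤ) : ℝ) : ℂ) * x * Complex.I) * (F x : ℂ) := by
  set E : ℝ → ℂ := fun x => Complex.exp (((π * (-n : ℤ) : ℝ) : ℂ) * x * Complex.I) with hE
  have hEc : Continuous E := by fun_prop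
  have hEn : ∀ x, ‖E x‖ = 1 := fun x => by
    simp only [hE]; rw [← Complex.ofReal_mul, Complex.norm_exp_ofReal_mul_I]
  set γ := gaussianReal 0 v.toNNReal with hγ
  have h1 : ∀ x, E x * (hP v F x : ℂ) = ∫ y, E x * (F (x + y) : ℂ) ∂γ := by
    intro x
    rw [integral_const_mul, hP, integral_complex_ofReal]
  change ∫ x in (-1 : ℝ)..1, E x * (hP v F x : ℂ) = _ * ∫ x in (-1 : ℝ)..1, E x * (F x : ℂ)
  simp_rw [h1]
  rw [intervalIntegral_integral_swap]
  swap
  · have : IsFiniteMeasure (volume.restrict (Set.uIoc (-1 : ℝ) 1)) :=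
      ⟨by rw [Set.uIoc_of_le (by norm_num)]; simp⟩
    refine Integrable.of_bound (C := K) ?_ ?_
    · apply Continuous.aestronglyMeasurable
      unfold Function.uncurry
      fun_prop
    · refine Filter.Eventually.of_forall fun p => ?_
      simp only [Function.uncurry, norm_mul, hEn, one_mul, Complex.norm_real]
      exact hK _
  have hEper : Function.Periodic (fun x => E x * (F x : ℂ)) 2 := by
    intro x
    simp only [hper]
    congr 1
    simp only [hE]
    rw [Complex.exp_eq_exp_iff_exists_int]
    exact ⟨-n, by push_cast; ring⟩
  have h2 : ∀ y : ℝ, ∫ x in (-1 : ℝ)..1, E x * (F (x + y) : ℂ) =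
      Complex.exp (((π * n : ℝ) : ℂ) * y * Complex.I) * ∫ x in (-1 : ℝ)..1, E x * (F x : ℂ) := by
    intro y
    have e : ∀ x : ℝ, E x * (F (x + y) : ℂ) = Complex.exp (((π * n : ℝ) : ℂ) * y * Complex.I) *
        (fun x => E x * (F x : ℂ)) (x + y) := by
      intro x
      simp only [hE]
      rw [← mul_assoc, ← Complex.exp_add]
      congr 2; push_cast; ring
    simp_rw [e]
    rw [intervalIntegral.integral_const_mul, intervalIntegral.integral_comp_add_right
      (fun x => E x * (F x : ℂ))]
    congr 1
    have := hEper.intervalIntegral_add_eq (-1 + y) (-1)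
    rw [show (-1 : ℝ) + y + 2 = 1 + y by ring, show (-1 : ℝ) + 2 = 1 by norm_num] at this
    exact this
  simp_rw [h2]
  rw [integral_mul_const, ← charFun_apply_real, charFun_gaussianReal, Real.coe_toNNReal v hv]
  congr 1
  push_cast
  congr 1; ring

lemma bridge {F : ℝ → ℝ} (hF : Continuous F) {K : ℝ} (hK : ∀ x, |F x| ≤ K)
    (hper : ∀ x, F (x + 2) = F x) (hodd : ∀ x, F (-x) = -F x) {ϑ r : ℝ} (hϑ : 0 < ϑ)
    (hr : 0 < r) (x : ℝ) :
    HasSum (fun ℓ : ℕ => Real.exp (-(ϑ * Real.pi ^ 2 * ((ℓ : ℝ) + 1) ^ 2 * r))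
      * (∫ y in (0 : ℝ)..1, F y * sineB (ℓ + 1) y) * sineB (ℓ + 1) x) (hP (2 * ϑ * r) F x) := by
  have : Fact ((0 : ℝ) < 2) := ⟨two_pos⟩
  set v := 2 * ϑ * r with hvdef
  have hv : 0 < v := by positivity
  have hQper : Function.Periodic (fun x => (hP v F x : ℂ)) 2 := by
    intro x
    simp only [hP]
    congr 2; ext y
    rw [add_right_comm, hper]
  have hQc := hP_cont hF hK v
  let Q : C(AddCircle (2 : ℝ), ℂ) := ⟨hQper.lift, by
    rw [(QuotientAddGroup.isQuotientMap_mk (AddSubgroup.zmultiples (2 : ℝ))).continuous_iff]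
    change Continuous fun x => (hP v F x : ℂ)
    fun_prop⟩
  have hQ : ∀ x : ℝ, Q (x : AddCircle (2 : ℝ)) = (hP v F x : ℂ) := fun x => rfl
  set S : ℤ → ℝ := fun n => ∫ y in (0 : ℝ)..1, F y * Real.sin (π * n * y) with hS
  have hSb : ∀ n, |S n| ≤ K := by
    intro n
    have := intervalIntegral.norm_integral_le_of_norm_le_const (a := 0) (b := 1) (C := K)
      (f := fun y => F y * Real.sin (π * n * y)) (fun y _ => by
        rw [norm_mul]
        calc _ ≤ K * 1 := by
              gcongr
              · exact (abs_nonneg _).trans (hK 0)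
              · exact hK y
              · exact Real.abs_sin_le_one _
          _ = K := mul_one _)
    simpa using this
  have hSneg : ∀ n, S (-n) = - S n := by
    intro n
    simp only [hS]
    rw [← intervalIntegral.integral_neg]
    congr 1; ext y; push_cast
    rw [show π * -(n : ℝ) * y = -(π * n * y) by ring, Real.sin_neg]; ring
  have hco : ∀ n : ℤ, fourierCoeff Q n =
      (Real.exp (-(v * (π * n) ^ 2 / 2)) : ℂ) * (-Complex.I * S n) := by
    intro n
    rw [fourierCoeff_eq_intervalIntegral _ _ (-1), show (-1 : ℝ) + 2 = 1 by norm_num]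
    simp_rw [hQ, fou_two, smul_eq_mul]
    rw [hP_coef hF hK hper hv.le, odd_coef hF hodd]
    rw [Complex.real_smul]
    push_cast; ring
  have hsum : Summable (fourierCoeff Q) := by
    have hg : Summable fun n : ℤ => K * Real.exp (-(v * (π * n) ^ 2 / 2)) := by
      apply Summable.mul_left
      apply Summable.of_nat_of_neg <;>
      · have : Summable fun n : ℕ => Real.exp (-(v * π ^ 2 / 2)) ^ n :=
          summable_geometric_of_lt_one (Real.exp_pos _).le
            (Real.exp_lt_one_iff.2 (by have := Real.pi_pos; simp; positivity))
        refine this.of_nonneg_of_le (fun n => (Real.exp_pos _).le) fun n => ?_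
        rw [← Real.exp_nat_mul, Real.exp_le_exp]
        push_cast
        have hn : (n : ℝ) ≤ (n : ℝ) ^ 2 := by
          have : n ≤ n ^ 2 := Nat.le_self_pow two_ne_zero n
          exact_mod_cast this
        have := mul_le_mul_of_nonneg_left hn (show 0 ≤ v * π ^ 2 / 2 by positivity)
        linarith
    refine Summable.of_norm_bounded hg fun n => ?_
    rw [hco, norm_mul, norm_mul, norm_neg, Complex.norm_I, one_mul, Complex.norm_real,
      Complex.norm_real, mul_comm, Real.norm_eq_abs, Real.norm_eq_abs, abs_of_pos (Real.exp_pos _)]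
    gcongr
    exact hSb n
  have hs := has_pointwise_sum_fourier_series_of_summable hsum (x : AddCircle (2 : ℝ))
  rw [hQ] at hs
  have hs2 := hs.nat_add_neg
  rw [← hasSum_nat_add_iff' 1] at hs2
  rw [← Complex.hasSum_ofReal]
  have hS0 : S 0 = 0 := by simp [hS]
  have hval : ((hP v F x : ℝ) : ℂ) + fourierCoeff (⇑Q) 0 • (fourier 0) (x : AddCircle (2 : ℝ)) -
      ∑ i ∈ Finset.range 1, (fourierCoeff (⇑Q) (i : ℤ) • (fourier (i : ℤ)) (x : AddCircle (2 : ℝ)) +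
        fourierCoeff (⇑Q) (-(i : ℤ)) • (fourier (-(i : ℤ))) (x : AddCircle (2 : ℝ))) =
      ((hP v F x : ℝ) : ℂ) := by
    simp [hco, hS0]
  rw [hval] at hs2
  refine (congrArg (fun f => HasSum f ((hP v F x : ℝ) : ℂ)) (funext fun ℓ => ?_)).mpr hs2
  rw [hco, hco, fou_two, fou_two, hSneg]
  have hi : (∫ y in (0 : ℝ)..1, F y * sineB (ℓ + 1) y) = √2 * S ((ℓ + 1 : ℕ) : ℤ) := by
    simp only [hS, sineB]
    rw [← intervalIntegral.integral_const_mul]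
    congr 1; ext y; push_cast; ring
  rw [hi]
  simp only [sineB, smul_eq_mul]
  push_cast
  have e1 : (π : ℂ) * -((ℓ : ℂ) + 1) * x * Complex.I = (-(π * (ℓ + 1) * x) : ℂ) * Complex.I := by
    ring
  have e2 : -((v : ℂ) * (π * -((ℓ : ℂ) + 1)) ^ 2 / 2) = -(v * (π * ((ℓ : ℂ) + 1)) ^ 2 / 2) := by
    ring
  have e3 : -(ϑ * (π : ℂ) ^ 2 * ((ℓ : ℂ) + 1) ^ 2 * r) = -(v * (π * ((ℓ : ℂ) + 1)) ^ 2 / 2) := by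
    rw [hvdef]; push_cast; ring
  have e4 : ((√2 : ℝ) : ℂ) * ((√2 : ℝ) : ℂ) = 2 := by
    rw [← Complex.ofReal_mul, Real.mul_self_sqrt two_pos.le]; norm_num
  rw [e1, e2, e3, Complex.exp_mul_I, Complex.exp_mul_I, Complex.cos_neg, Complex.sin_neg]
  linear_combination (Complex.exp (-(v * (π * ((ℓ : ℂ) + 1)) ^ 2 / 2)) *
    (S ((ℓ : ℤ) + 1)) * Complex.sin (π * (ℓ + 1) * x)) * (e4 + 2 * Complex.I_mul_I)

/-- Distance to the even integers. -/
noncomputable def dEv (x : ℝ) : ℝ := ‖(x : AddCircle (2 : ℝ))‖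

/-- Odd, two-periodic extension of a function on the unit interval. -/
noncomputable def oExt (f : ℝ → ℝ) (x : ℝ) : ℝ := Real.sign (Real.sin (π * x)) * f (dEv x)

lemma dEv_nonneg (x : ℝ) : 0 ≤ dEv x := norm_nonneg _

lemma dEv_le_one (x : ℝ) : dEv x ≤ 1 := by
  have := AddCircle.norm_le_half_period (2 : ℝ) (x := (x : AddCircle (2 : ℝ))) two_ne_zero
  simpa [dEv] using this

lemma dEv_mem (x : ℝ) : dEv x ∈ Set.Icc (0 : ℝ) 1 := ⟨dEv_nonneg x, dEv_le_one x⟩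

lemma dEv_of_abs {x : ℝ} (hx : |x| ≤ 1) : dEv x = |x| := by
  unfold dEv
  rw [AddCircle.norm_coe_eq_abs_iff (2 : ℝ) two_ne_zero]
  simpa using hx

lemma dEv_neg (x : ℝ) : dEv (-x) = dEv x := by
  unfold dEv; rw [AddCircle.coe_neg, norm_neg]

lemma dEv_add_two (x : ℝ) : dEv (x + 2) = dEv x := by
  unfold dEv; rw [AddCircle.coe_add_period]

lemma dEv_le_abs (x : ℝ) : dEv x ≤ |x| := by
  by_cases h : |x| ≤ 1
  · exact (dEv_of_abs h).le
  · exact (dEv_le_one x).trans (not_le.1 h).le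

lemma dEv_lip (x y : ℝ) : |dEv x - dEv y| ≤ |x - y| := by
  refine le_trans ?_ (dEv_le_abs (x - y))
  unfold dEv
  rw [AddCircle.coe_sub]
  exact abs_norm_sub_norm_le _ _

lemma dEv_int (n : ℤ) : dEv n = 0 ∨ dEv n = 1 := by
  rcases Int.even_or_odd' n with ⟨k, rfl | rfl⟩
  · left
    have : (((2 * k : ℤ) : ℝ) : AddCircle (2 : ℝ)) = 0 := by
      rw [AddCircle.coe_eq_zero_iff]
      exact ⟨k, by push_cast; simp; ring⟩
    unfold dEv; rw [this, norm_zero]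
  · right
    have : (((2 * k + 1 : ℤ) : ℝ) : AddCircle (2 : ℝ)) = ((1 : ℝ) : AddCircle (2 : ℝ)) := by
      have h : (((2 * k : ℤ) : ℝ) : AddCircle (2 : ℝ)) = 0 := by
        rw [AddCircle.coe_eq_zero_iff]
        exact ⟨k, by push_cast; simp; ring⟩
      push_cast at h ⊢
      rw [AddCircle.coe_add, h, zero_add]
    have h1 := dEv_of_abs (x := 1) (by simp)
    unfold dEv at h1 ⊢
    rw [this, h1, abs_one]

lemma sin_zero_dEv {f : ℝ → ℝ} (h0 : f 0 = 0) (h1 : f 1 = 0) {z : ℝ}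
    (hz : Real.sin (π * z) = 0) : f (dEv z) = 0 := by
  rw [Real.sin_eq_zero_iff] at hz
  obtain ⟨n, hn⟩ := hz
  have : z = n := by
    have := Real.pi_ne_zero
    field_simp at hn
    exact hn.symm
  rw [this]
  rcases dEv_int n with h | h <;> rw [h] <;> assumption

lemma abs_sign_le (x : ℝ) : |Real.sign x| ≤ 1 := by
  rcases Real.sign_apply_eq x with h | h | h <;> rw [h] <;> norm_num

lemma oExt_odd (f : ℝ → ℝ) (x : ℝ) : oExt f (-x) = -oExt f x := by
  unfold oExt
  rw [mul_neg, Real.sin_neg, Real.sign_neg, dEv_neg, neg_mul]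

lemma oExt_per (f : ℝ → ℝ) (x : ℝ) : oExt f (x + 2) = oExt f x := by
  unfold oExt
  rw [dEv_add_two, show π * (x + 2) = π * x + 2 * π by ring, Real.sin_add_two_pi]

lemma oExt_bound {f : ℝ → ℝ} {B : ℝ} (hb : ∀ x ∈ Set.Icc (0 : ℝ) 1, |f x| ≤ B) (x : ℝ) :
    |oExt f x| ≤ B := by
  unfold oExt
  rw [abs_mul]
  have := hb _ (dEv_mem x)
  nlinarith [abs_sign_le (Real.sin (π * x)), abs_nonneg (f (dEv x))]

lemma oExt_eq {f : ℝ → ℝ} (h0 : f 0 = 0) (h1 : f 1 = 0) {x : ℝ} (hx : x ∈ Set.Icc (0 : ℝ) 1) :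
    oExt f x = f x := by
  have hd : dEv x = x := by
    rw [dEv_of_abs (abs_le.2 ⟨by linarith [hx.1], hx.2⟩), abs_of_nonneg hx.1]
  rcases eq_or_lt_of_le hx.1 with h | h
  · rw [← h] at hd ⊢; simp [oExt, h0]
  rcases eq_or_lt_of_le hx.2 with h' | h'
  · rw [h']; simp [oExt, h1]
  have : 0 < Real.sin (π * x) := Real.sin_pos_of_pos_of_lt_pi (by have := Real.pi_pos; positivity)
    (by nlinarith [Real.pi_pos])
  rw [oExt, Real.sign_of_pos this, one_mul, hd]

lemma oExt_holder {f : ℝ → ℝ} (h0 : f 0 = 0) (h1 : f 1 = 0) {B κ : ℝ} (hκ : 0 ≤ κ) (hB : 0 ≤ B)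
    (hh : ∀ x ∈ Set.Icc (0 : ℝ) 1, ∀ y ∈ Set.Icc (0 : ℝ) 1, |f x - f y| ≤ B * |x - y| ^ κ)
    (x y : ℝ) : |oExt f x - oExt f y| ≤ 2 * B * |x - y| ^ κ := by
  have hcmp : ∀ a b : ℝ, |f (dEv a) - f (dEv b)| ≤ B * |a - b| ^ κ := by
    intro a b
    refine (hh _ (dEv_mem a) _ (dEv_mem b)).trans ?_
    exact mul_le_mul_of_nonneg_left
      (Real.rpow_le_rpow (abs_nonneg _) (dEv_lip a b) hκ) hB
  by_cases hz : ∃ z ∈ Set.uIcc x y, Real.sin (π * z) = 0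
  · obtain ⟨z, hz, hs⟩ := hz
    have hfz := sin_zero_dEv h0 h1 hs
    have key : ∀ a ∈ Set.uIcc x y, |oExt f a| ≤ B * |x - y| ^ κ := by
      intro a ha
      have h2 := hcmp a z
      rw [hfz, sub_zero] at h2
      have h3 : |oExt f a| ≤ |f (dEv a)| := by
        unfold oExt; rw [abs_mul]
        exact mul_le_of_le_one_left (abs_nonneg _) (abs_sign_le _)
      refine h3.trans (h2.trans ?_)
      have h4 := Set.abs_sub_le_of_uIcc_subset_uIcc (Set.uIcc_subset_uIcc ha hz)
      rw [abs_sub_comm, abs_sub_comm y] at h4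
      exact mul_le_mul_of_nonneg_left (Real.rpow_le_rpow (abs_nonneg _) h4 hκ) hB
    have := key x Set.left_mem_uIcc
    have := key y Set.right_mem_uIcc
    have := abs_sub (oExt f x) (oExt f y)
    linarith
  · push Not at hz
    have hsg : Real.sign (Real.sin (π * x)) = Real.sign (Real.sin (π * y)) := by
      have hx := hz x Set.left_mem_uIcc
      have hy := hz y Set.right_mem_uIcc
      have hc : ContinuousOn (fun z => Real.sin (π * z)) (Set.uIcc x y) := by fun_prop
      have hiv := intermediate_value_uIcc hc
      have h00 : (0 : ℝ) ∉ Set.uIcc (Real.sin (π * x)) (Real.sin (π * y)) := by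
        intro h
        obtain ⟨z, hzz, hz0⟩ := hiv h
        exact hz z hzz hz0
      rcases lt_or_gt_of_ne hx with a | a <;> rcases lt_or_gt_of_ne hy with b | b
      · rw [Real.sign_of_neg a, Real.sign_of_neg b]
      · exact absurd (Set.mem_uIcc.2 (Or.inl ⟨a.le, b.le⟩)) h00
      · exact absurd (Set.mem_uIcc.2 (Or.inr ⟨b.le, a.le⟩)) h00
      · rw [Real.sign_of_pos a, Real.sign_of_pos b]
    unfold oExt
    rw [hsg, ← mul_sub, abs_mul]
    have := hcmp x y
    have h3 := mul_le_of_le_one_left (abs_nonneg (f (dEv x) - f (dEv y)))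
      (abs_sign_le (Real.sin (π * y)))
    have : 0 ≤ B * |x - y| ^ κ := by positivity
    linarith

lemma oExt_cont {F : ℝ → ℝ} {M κ : ℝ} (hκ : 0 < κ)
    (hh : ∀ x y : ℝ, |F x - F y| ≤ M * |x - y| ^ κ) : Continuous F := by
  rw [continuous_iff_continuousAt]
  intro a
  rw [ContinuousAt, tendsto_iff_norm_sub_tendsto_zero]
  refine squeeze_zero (fun x => norm_nonneg _) (fun x => hh x a) ?_
  have : ContinuousAt (fun x : ℝ => M * |x - a| ^ κ) a := by
    refine continuousAt_const.mul (ContinuousAt.rpow_const ?_ (Or.inr hκ.le))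
    fun_prop
  have h := this.tendsto
  simpa [Real.zero_rpow hκ.ne'] using h

lemma interp {X K a b p : ℝ} (hK : 0 ≤ K) (ha : 0 < a) (hb : 0 < b) (h0 : 0 ≤ p) (h1 : p ≤ 1)
    (hXa : X ≤ K * a) (hXb : X ≤ K * b) : X ≤ K * (a ^ (1 - p) * b ^ p) := by
  have key : min a b ≤ a ^ (1 - p) * b ^ p := by
    have hm : 0 < min a b := lt_min ha hb
    calc min a b = (min a b) ^ (1 - p) * (min a b) ^ p := by
          rw [← Real.rpow_add hm]; simp
      _ ≤ a ^ (1 - p) * b ^ p := by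
          have := sub_nonneg.2 h1
          gcongr
          · exact min_le_left _ _
          · exact min_le_right _ _
  have : X ≤ K * min a b := by
    rcases min_choice a b with h | h <;> rw [h] <;> assumption
  exact this.trans (mul_le_mul_of_nonneg_left key hK)

lemma sp_bound {F : ℝ → ℝ} (hF : Continuous F) {K : ℝ} (hK : ∀ x, |F x| ≤ K) {M γ α e : ℝ}
    (hM : 0 ≤ M) (hγ0 : 0 < γ) (he : 0 ≤ e) (heγ : e ≤ 1 - γ) (hγ1 : γ < 1) (hα : α ≤ γ + e)
    (hH : ∀ x y, |F (x + y) - F x| ≤ M * |y| ^ γ) {v : ℝ} (hv : 0 < v) {δ : ℝ} (hδ : 0 < δ)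
    (hδ1 : δ ≤ 1) (y : ℝ) :
    |hP v F (y + δ) - hP v F y| ≤ 2 * M * (δ ^ α * v ^ (-(e / 2))) := by
  have b2 := hP_lip hF hK hγ0.le hγ1.le hM hH hv y δ
  rw [abs_of_pos hδ] at b2
  have b1 : |hP v F (y + δ) - hP v F y| ≤ M * δ ^ γ := by
    rw [← hP_shift v δ y, ← hP_sub (f := fun z => F (z + δ)) (by fun_prop)
      (fun x => hK _) hF hK]
    refine hP_bound (fun x => ?_) v y
    have := hH x δ
    rwa [abs_of_pos hδ] at this
  have hp1 : 0 < 1 - γ := by linarith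
  have := interp (p := e / (1 - γ)) (K := 2 * M) (a := δ ^ γ) (b := δ * v ^ ((γ - 1) / 2))
    (by positivity) (by positivity) (by positivity) (by positivity)
    ((div_le_one hp1).2 heγ) (b1.trans (by nlinarith [mul_nonneg hM (Real.rpow_nonneg hδ.le γ)]))
    (b2.trans (le_of_eq (by ring)))
  refine this.trans (mul_le_mul_of_nonneg_left ?_ (by positivity))
  rw [Real.mul_rpow hδ.le (by positivity), ← Real.rpow_mul hδ.le, ← mul_assoc,
    ← Real.rpow_add hδ, ← Real.rpow_mul hv.le]
  have e1 : γ * (1 - e / (1 - γ)) + e / (1 - γ) = γ + e := by field_simp; ring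
  have e2 : (γ - 1) / 2 * (e / (1 - γ)) = -(e / 2) := by field_simp; ring
  rw [e1, e2]
  exact mul_le_mul_of_nonneg_right (Real.rpow_le_rpow_of_exponent_ge hδ hδ1 hα) (by positivity)

lemma db_bound {F : ℝ → ℝ} (hF : Continuous F) {K : ℝ} (hK : ∀ x, |F x| ≤ K) {M κ α : ℝ}
    (hM : 0 ≤ M) (hκ0 : 0 ≤ κ) (hκ1 : κ ≤ 1) (hα0 : 0 ≤ α) (hα1 : α ≤ 1)
    (hH : ∀ x y, |F (x + y) - F x| ≤ M * |y| ^ κ) {v h : ℝ} (hv : 0 < v) (hh : 0 ≤ h)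
    {δ : ℝ} (hδ : 0 < δ) (y : ℝ) :
    |(hP (v + h) F (y + δ) - hP v F (y + δ)) - (hP (v + h) F y - hP v F y)| ≤
      128 * M * h * (δ ^ α * v ^ (-1 - (α - κ) / 2)) := by
  have b2 := hP_double hF hK hκ0 hκ1 hM hH hv hh y δ
  rw [abs_of_pos hδ] at b2
  have t1 := hP_time hF hK hκ0 hκ1 hM hH hv hh y
  have t2 := hP_time hF hK hκ0 hκ1 hM hH hv hh (y + δ)
  have b1 := (abs_sub (hP (v + h) F (y + δ) - hP v F (y + δ)) (hP (v + h) F y - hP v F y))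
  have hp : 0 ≤ M * v ^ (κ / 2 - 1) * h := by positivity
  have := interp (p := α) (K := 128 * (M * v ^ (κ / 2 - 1) * h)) (a := 1)
    (b := δ * v ^ (-(1 / 2) : ℝ))
    (by positivity) (by positivity) (by positivity) hα0 hα1
    (b1.trans (by nlinarith)) (b2.trans (le_of_eq (by ring)))
  refine this.trans (le_of_eq ?_)
  rw [Real.one_rpow, one_mul, Real.mul_rpow hδ.le (by positivity), ← Real.rpow_mul hv.le]
  have : v ^ (-1 - (α - κ) / 2) = v ^ (κ / 2 - 1) * v ^ (-(1 / 2) * α) := by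
    rw [← Real.rpow_add hv]; congr 1; ring
  rw [this]; ring

/-- Integrable majorant. -/
noncomputable def maj (m n v : ℝ) : ℝ := if v ≤ 1 then v ^ (-m) else v ^ (-n)

lemma maj_nonneg (m n : ℝ) {v : ℝ} (hv : 0 < v) : 0 ≤ maj m n v := by
  unfold maj; split_ifs <;> positivity

lemma maj_int {m n : ℝ} (hm : m < 1) (hn : 1 < n) : IntegrableOn (maj m n) (Set.Ioi 0) := by
  have hu : Set.Ioi (0 : ℝ) = Set.Ioc 0 1 ∪ Set.Ioi 1 := by
    rw [Set.Ioc_union_Ioi_eq_Ioi zero_le_one]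
  rw [hu]
  apply IntegrableOn.union
  · have h := (intervalIntegral.intervalIntegrable_rpow' (a := 0) (b := 1) (r := -m)
      (by linarith))
    rw [intervalIntegrable_iff_integrableOn_Ioc_of_le zero_le_one] at h
    refine h.congr_fun (fun x hx => ?_) measurableSet_Ioc
    simp [maj, hx.2]
  · have h := integrableOn_Ioi_rpow_of_lt (a := -n) (c := 1) (by linarith) one_pos
    refine h.congr_fun (fun x hx => ?_) measurableSet_Ioi
    simp [maj, not_le.2 (Set.mem_Ioi.1 hx)]

lemma full_bound {F : ℝ → ℝ} (hF : Continuous F) {B γ α θ : ℝ} (hK : ∀ x, |F x| ≤ B)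
    (hB : 0 ≤ B) (hγ0 : 0 < γ) (hγ1 : γ < 1) (hα0 : 0 < α) (hα1 : α < 1) (hθ0 : 0 < θ)
    (hθ1 : θ ≤ 1)
    (hH : ∀ x y, |F (x + y) - F x| ≤ 2 * B * |y| ^ γ) {v c Δ : ℝ} (hv : 0 < v) (hc : 0 < c)
    (hΔ : 0 < Δ) (hΔ1 : Δ ≤ 1) {δ : ℝ} (hδ : 0 < δ) (hδ1 : δ ≤ 1) (y : ℝ) :
    |(hP (v + c * Δ) F (y + δ) - hP v F (y + δ)) - (hP (v + c * Δ) F y - hP v F y)| ≤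
      256 * (c + c ^ θ) * B * δ ^ α * Δ ^ θ *
        maj ((1 - θ) * (max (α - γ) 0 / 2) + θ * (1 + (α - γ) / 2)) (1 + α / 2) v := by
  set e := max (α - γ) 0 with he
  have hM : 0 ≤ 2 * B := by positivity
  have he0 : 0 ≤ e := le_max_right _ _
  have he1 : e ≤ 1 - γ := max_le (by linarith) (by linarith)
  have hea : α ≤ γ + e := by have := le_max_left (α - γ) 0; linarith
  have hcΔ : 0 < c * Δ := by positivity
  have hH0 : ∀ x y, |F (x + y) - F x| ≤ 2 * B * |y| ^ (0 : ℝ) := by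
    intro x y
    rw [Real.rpow_zero, mul_one]
    have := abs_sub (F (x + y)) (F x)
    linarith [hK (x + y), hK x]
  have hcθ : 0 ≤ c ^ θ := by positivity
  unfold maj
  split_ifs with hv1
  · have b2 := db_bound hF hK hM hγ0.le hγ1.le hα0.le hα1.le hH hv hcΔ.le hδ y
    have s1 := sp_bound hF hK hM hγ0 he0 he1 hγ1 hea hH hv hδ hδ1 y
    have s2 := sp_bound hF hK hM hγ0 he0 he1 hγ1 hea hH (add_pos hv hcΔ) hδ hδ1 y
    have s3 : (v + c * Δ) ^ (-(e / 2)) ≤ v ^ (-(e / 2)) :=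
      Real.rpow_le_rpow_of_nonpos hv (by linarith) (by linarith)
    have s4 : |hP (v + c * Δ) F (y + δ) - hP (v + c * Δ) F y| ≤
        2 * (2 * B) * (δ ^ α * v ^ (-(e / 2))) := s2.trans (by gcongr)
    have b1 := abs_sub (hP (v + c * Δ) F (y + δ) - hP (v + c * Δ) F y)
      (hP v F (y + δ) - hP v F y)
    rw [show hP (v + c * Δ) F (y + δ) - hP (v + c * Δ) F y - (hP v F (y + δ) - hP v F y) =
      (hP (v + c * Δ) F (y + δ) - hP v F (y + δ)) - (hP (v + c * Δ) F y - hP v F y) by ring] at b1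
    have hp : 0 ≤ B * δ ^ α * v ^ (-(e / 2)) := by positivity
    have := interp (p := θ) (K := 256 * B * δ ^ α) (a := v ^ (-(e / 2)))
      (b := c * Δ * v ^ (-1 - (α - γ) / 2)) (by positivity) (by positivity) (by positivity) hθ0.le
      hθ1 (b1.trans (by nlinarith)) (b2.trans (le_of_eq (by ring)))
    refine this.trans ?_
    rw [Real.mul_rpow hcΔ.le (by positivity), Real.mul_rpow hc.le hΔ.le, ← Real.rpow_mul hv.le,
      ← Real.rpow_mul hv.le]
    have ee : v ^ (-((1 - θ) * (e / 2) + θ * (1 + (α - γ) / 2))) =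
        v ^ (-(e / 2) * (1 - θ)) * v ^ ((-1 - (α - γ) / 2) * θ) := by
      rw [← Real.rpow_add hv]; congr 1; ring
    rw [ee]
    have hq : 0 ≤ B * δ ^ α * Δ ^ θ * (v ^ (-(e / 2) * (1 - θ)) * v ^ ((-1 - (α - γ) / 2) * θ)) := by
      positivity
    nlinarith [mul_nonneg hc.le hq]
  · have b2 := db_bound hF hK hM le_rfl zero_le_one hα0.le hα1.le hH0 hv hcΔ.le hδ y
    refine b2.trans ?_
    have hd : Δ ≤ Δ ^ θ := by
      have := Real.rpow_le_rpow_of_exponent_ge hΔ hΔ1 hθ1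
      rwa [Real.rpow_one] at this
    rw [show -1 - (α - 0) / 2 = -(1 + α / 2) by ring]
    have hq : 0 ≤ B * δ ^ α * v ^ (-(1 + α / 2)) := by positivity
    calc _ = 256 * c * (B * δ ^ α * v ^ (-(1 + α / 2))) * Δ := by ring
      _ ≤ 256 * (c + c ^ θ) * (B * δ ^ α * v ^ (-(1 + α / 2))) * Δ ^ θ := by
          gcongr
          linarith
      _ = _ := by ring

lemma fCoef_meas {g : ℝ → ℝ → ℝ}
    (hg : ContinuousOn (fun q : ℝ × ℝ => g q.1 q.2) (Set.Ici 0 ×ˢ Set.Icc 0 1)) (ℓ : ℕ) (t : ℝ) :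
    AEStronglyMeasurable (fCoef g ℓ) (volume.restrict (Set.Ioc 0 t)) := by
  have hproj : Continuous fun q : ℝ × ℝ => g (max q.1 0) (max 0 (min 1 q.2)) := by
    refine hg.comp_continuous (f := fun q : ℝ × ℝ => (max q.1 0, max 0 (min 1 q.2)))
      (by fun_prop) fun q => ?_
    refine ⟨Set.mem_Ici.2 (le_max_right _ _), le_max_left _ _, max_le zero_le_one (min_le_left _ _)⟩
  have hsc : Continuous (sineB ℓ) := by unfold sineB; fun_prop
  have hc : Continuous fun s : ℝ => ∫ y in (0 : ℝ)..1,
      g (max s 0) (max 0 (min 1 y)) * sineB ℓ y := by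
    apply intervalIntegral.continuous_parametric_intervalIntegral_of_continuous'
    unfold Function.uncurry
    exact hproj.mul (hsc.comp continuous_snd)
  refine hc.aestronglyMeasurable.congr ?_
  refine (ae_restrict_iff' measurableSet_Ioc).2 (.of_forall fun s hs => ?_)
  unfold fCoef
  refine intervalIntegral.integral_congr fun y hy => ?_
  rw [Set.uIcc_of_le zero_le_one] at hy
  rw [max_eq_left hs.1.le, min_eq_right hy.2, max_eq_right hy.1]

lemma rep {g : ℝ → ℝ → ℝ} {B γ ϑ : ℝ} (hϑ : 0 < ϑ) (hγ : 0 < γ) (hB : 0 ≤ B)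
    (hg : ContinuousOn (fun q : ℝ × ℝ => g q.1 q.2) (Set.Ici 0 ×ˢ Set.Icc 0 1))
    (h01 : ∀ s : ℝ, 0 ≤ s → g s 0 = 0 ∧ g s 1 = 0)
    (hb : ∀ s : ℝ, 0 ≤ s → ∀ x ∈ Set.Icc (0 : ℝ) 1, |g s x| ≤ B)
    (hh : ∀ s : ℝ, 0 ≤ s → ∀ x ∈ Set.Icc (0 : ℝ) 1, ∀ y ∈ Set.Icc (0 : ℝ) 1,
        |g s x - g s y| ≤ B * |x - y| ^ γ) {t : ℝ} (ht : 0 ≤ t) (x : ℝ) :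
    IntervalIntegrable (fun s => hP (2 * ϑ * (t - s)) (oExt (g s)) x) volume 0 t ∧
    heatConv ϑ g t x = ∫ s in (0 : ℝ)..t, hP (2 * ϑ * (t - s)) (oExt (g s)) x := by
  have hS : ∀ s, 0 ≤ s → s < t → HasSum (fun ℓ : ℕ =>
      Real.exp (-(ϑ * Real.pi ^ 2 * ((ℓ : ℝ) + 1) ^ 2 * (t - s)))
      * fCoef g (ℓ + 1) s * sineB (ℓ + 1) x) (hP (2 * ϑ * (t - s)) (oExt (g s)) x) := by
    intro s hs hst
    have hc : Continuous (oExt (g s)) := oExt_cont hγ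
      (oExt_holder (h01 s hs).1 (h01 s hs).2 hγ.le hB (hh s hs))
    have := bridge hc (oExt_bound (hb s hs)) (oExt_per _) (oExt_odd _) hϑ (sub_pos.2 hst) x
    refine (congrArg (fun f => HasSum f _) (funext fun ℓ => ?_)).mpr this
    have hf : fCoef g (ℓ + 1) s = ∫ y in (0 : ℝ)..1, oExt (g s) y * sineB (ℓ + 1) y := by
      unfold fCoef
      refine intervalIntegral.integral_congr fun y hy => ?_
      rw [Set.uIcc_of_le zero_le_one] at hy
      rw [oExt_eq (h01 s hs).1 (h01 s hs).2 hy]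
    rw [hf]
  have hae : ∀ᵐ s ∂(volume.restrict (Set.Ioc 0 t)), 0 ≤ s ∧ s < t := by
    rw [ae_restrict_iff' measurableSet_Ioc]
    filter_upwards [(measure_eq_zero_iff_ae_notMem.1 (measure_singleton (μ := volume) t))]
      with s hs hs2
    exact ⟨hs2.1.le, lt_of_le_of_ne hs2.2 hs⟩
  have hmeas : AEStronglyMeasurable (fun s => hP (2 * ϑ * (t - s)) (oExt (g s)) x)
      (volume.restrict (Set.Ioc 0 t)) := by
    refine aestronglyMeasurable_of_tendsto_ae Filter.atTop
      (f := fun (n : ℕ) s => ∑ ℓ ∈ Finset.range n,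
        Real.exp (-(ϑ * Real.pi ^ 2 * ((ℓ : ℝ) + 1) ^ 2 * (t - s)))
        * fCoef g (ℓ + 1) s * sineB (ℓ + 1) x) (fun n => ?_) ?_
    · refine Finset.aestronglyMeasurable_fun_sum _ fun ℓ _ => ?_
      refine AEStronglyMeasurable.mul_const (AEStronglyMeasurable.mul ?_ (fCoef_meas hg _ _)) _
      exact Continuous.aestronglyMeasurable (by fun_prop)
    · filter_upwards [hae] with s hs
      exact (hS s hs.1 hs.2).tendsto_sum_nat
  refine ⟨?_, ?_⟩
  · rw [intervalIntegrable_iff_integrableOn_Ioc_of_le ht]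
    have : IsFiniteMeasure (volume.restrict (Set.Ioc 0 t)) := ⟨by simp⟩
    refine Integrable.of_bound hmeas B ?_
    filter_upwards [hae] with s hs
    exact hP_bound (oExt_bound (hb s hs.1)) _ _
  · unfold heatConv
    rw [intervalIntegral.integral_of_le ht, intervalIntegral.integral_of_le ht]
    refine integral_congr_ae ?_
    filter_upwards [hae] with s hs
    exact (hS s hs.1 hs.2).tsum_eq

set_option maxHeartbeats 1000000

/-- Double (space-time) increments of the heat convolution of a spatially `γ̃`-Hölder
continuous, bounded `g` vanishing on the lateral boundary: for `α ∈ (0,1)`, `β ∈ (0,1]` with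
`α + β < 1 + γ̃` there is a constant `C = C(α, β, γ̃, ϑ)` with
`|N(t+Δ, y+δ) − N(t+Δ, y) − N(t, y+δ) + N(t, y)| ≤ C·B·δ^α·Δ^{(1+β)/2}`. -/
theorem heatConv_double_increment_bound (ϑ γ' α β : ℝ) (hϑ : 0 < ϑ)
    (hγ' : γ' ∈ Set.Ioo (0 : ℝ) (1 / 2)) (hα : α ∈ Set.Ioo (0 : ℝ) 1)
    (hβ : β ∈ Set.Ioc (0 : ℝ) 1) (hαβ : α + β < 1 + γ') :
    ∃ C > (0 : ℝ), ∀ (g : ℝ → ℝ → ℝ) (B : ℝ),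
      ContinuousOn (fun q : ℝ × ℝ => g q.1 q.2) (Set.Ici 0 ×ˢ Set.Icc 0 1) →
      (∀ s : ℝ, 0 ≤ s → g s 0 = 0 ∧ g s 1 = 0) →
      (∀ s : ℝ, 0 ≤ s → ∀ x ∈ Set.Icc (0 : ℝ) 1, |g s x| ≤ B) →
      (∀ s : ℝ, 0 ≤ s → ∀ x ∈ Set.Icc (0 : ℝ) 1, ∀ y ∈ Set.Icc (0 : ℝ) 1,
        |g s x - g s y| ≤ B * |x - y| ^ γ') →
      ∀ t : ℝ, 0 ≤ t → ∀ Δ ∈ Set.Ioc (0 : ℝ) 1, ∀ δ ∈ Set.Ioc (0 : ℝ) 1,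
        ∀ y ∈ Set.Icc (0 : ℝ) 1, y + δ ≤ 1 →
          |heatConv ϑ g (t + Δ) (y + δ) - heatConv ϑ g (t + Δ) y
              - heatConv ϑ g t (y + δ) + heatConv ϑ g t y|
            ≤ C * B * δ ^ α * Δ ^ ((1 + β) / 2) := by
  obtain ⟨hγ0, hγ1⟩ := hγ'
  obtain ⟨hα0, hα1⟩ := hα
  obtain ⟨hβ0, hβ1⟩ := hβ
  set θ := (1 + β) / 2 with hθ
  have hθ0 : 0 < θ := by positivity
  have hθ1 : θ ≤ 1 := by linarith
  set e := max (α - γ') 0 with he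
  set m := (1 - θ) * (e / 2) + θ * (1 + (α - γ') / 2) with hm
  have he0 : 0 ≤ e := le_max_right _ _
  have he1 : e ≤ 1 - γ' := max_le (by linarith) (by linarith)
  have hea : α ≤ γ' + e := by have := le_max_left (α - γ') 0; linarith
  have heθ : θ ≤ 1 - e / 2 := by
    rcases max_choice (α - γ') 0 with h | h <;> rw [he, h] <;> linarith
  have hm1 : m < 1 := by
    rcases le_total γ' α with h | h
    · have : e = α - γ' := max_eq_left (by linarith)
      rw [hm, this]; nlinarith
    · have h0 : e = 0 := max_eq_right (by linarith)
      rcases h.eq_or_lt with h | h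
      · rw [hm, h0, h]; nlinarith
      · rw [hm, h0]; nlinarith
  have hI := maj_int hm1 (show 1 < 1 + α / 2 by linarith)
  set c := 2 * ϑ with hc
  have hc0 : 0 < c := by positivity
  set J := ∫ v in Set.Ioi (0 : ℝ), maj m (1 + α / 2) v with hJ
  have hJ0 : 0 ≤ J := setIntegral_nonneg measurableSet_Ioi fun v hv => maj_nonneg _ _ hv
  have hcθ : 0 < c ^ θ := by positivity
  refine ⟨256 * (c + c ^ θ) * (c⁻¹ * J) + 8 * c ^ (-(e / 2)), by positivity, ?_⟩
  intro g B hg h01 hb hh t ht Δ hΔ δ hδ y hy hyδ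
  obtain ⟨hΔ0, hΔ1⟩ := hΔ
  obtain ⟨hδ0, hδ1⟩ := hδ
  have hB : 0 ≤ B := (abs_nonneg _).trans (hb 0 le_rfl 0 ⟨le_rfl, zero_le_one⟩)
  have htΔ : 0 ≤ t + Δ := by linarith
  obtain ⟨i1, r1⟩ := rep hϑ hγ0 hB hg h01 hb hh htΔ (y + δ)
  obtain ⟨i2, r2⟩ := rep hϑ hγ0 hB hg h01 hb hh htΔ y
  obtain ⟨i3, r3⟩ := rep hϑ hγ0 hB hg h01 hb hh ht (y + δ)
  obtain ⟨i4, r4⟩ := rep hϑ hγ0 hB hg h01 hb hh ht y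
  rw [← hc] at i1 r1 i2 r2 i3 r3 i4 r4
  have hs1 : Set.uIcc 0 t ⊆ Set.uIcc 0 (t + Δ) := by
    rw [Set.uIcc_of_le ht, Set.uIcc_of_le htΔ]; exact Set.Icc_subset_Icc_right (by linarith)
  have hs2 : Set.uIcc t (t + Δ) ⊆ Set.uIcc 0 (t + Δ) := by
    rw [Set.uIcc_of_le (by linarith), Set.uIcc_of_le htΔ]; exact Set.Icc_subset_Icc_left ht
  have i1a := i1.mono_set hs1
  have i1b := i1.mono_set hs2
  have i2a := i2.mono_set hs1
  have i2b := i2.mono_set hs2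
  have hFc : ∀ s, 0 ≤ s → Continuous (oExt (g s)) := fun s hs => oExt_cont hγ0
      (oExt_holder (h01 s hs).1 (h01 s hs).2 hγ0.le hB (hh s hs))
  have hFH : ∀ s, 0 ≤ s → ∀ x z, |oExt (g s) (x + z) - oExt (g s) x| ≤ 2 * B * |z| ^ γ' := by
    intro s hs x z
    have := oExt_holder (h01 s hs).1 (h01 s hs).2 hγ0.le hB (hh s hs) (x + z) x
    rwa [add_sub_cancel_left] at this
  have hdec : heatConv ϑ g (t + Δ) (y + δ) - heatConv ϑ g (t + Δ) y
              - heatConv ϑ g t (y + δ) + heatConv ϑ g t y =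
      (∫ s in (0 : ℝ)..t, ((hP (c * (t + Δ - s)) (oExt (g s)) (y + δ) -
        hP (c * (t - s)) (oExt (g s)) (y + δ)) -
        (hP (c * (t + Δ - s)) (oExt (g s)) y - hP (c * (t - s)) (oExt (g s)) y))) +
      ∫ s in t..(t + Δ), (hP (c * (t + Δ - s)) (oExt (g s)) (y + δ) -
        hP (c * (t + Δ - s)) (oExt (g s)) y) := by
    rw [intervalIntegral.integral_sub (i1a.sub i3) (i2a.sub i4), intervalIntegral.integral_sub i1a i3,
      intervalIntegral.integral_sub i2a i4, intervalIntegral.integral_sub i1b i2b, r1, r2, r3, r4,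
      ← intervalIntegral.integral_add_adjacent_intervals i1a i1b,
      ← intervalIntegral.integral_add_adjacent_intervals i2a i2b]
    ring
  have hne : ∀ a : ℝ, ∀ᵐ s : ℝ, s ≠ a := fun a =>
    measure_eq_zero_iff_ae_notMem.1 (measure_singleton (μ := volume) a)
  have hmajI : IntervalIntegrable (fun s => maj m (1 + α / 2) (c * (t - s))) volume 0 t := by
    have h1 : IntervalIntegrable (maj m (1 + α / 2)) volume 0 (c * t) := by
      rw [intervalIntegrable_iff_integrableOn_Ioc_of_le (by positivity)]
      exact hI.mono_set Set.Ioc_subset_Ioi_self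
    have h2 := (h1.comp_mul_left (c := c)).comp_sub_left t
    rw [mul_div_cancel_left₀ _ hc0.ne'] at h2
    simp only [zero_div, sub_zero, sub_self] at h2
    exact h2.symm
  have p1 : ‖∫ s in (0 : ℝ)..t, ((hP (c * (t + Δ - s)) (oExt (g s)) (y + δ) -
        hP (c * (t - s)) (oExt (g s)) (y + δ)) -
        (hP (c * (t + Δ - s)) (oExt (g s)) y - hP (c * (t - s)) (oExt (g s)) y))‖ ≤
      256 * (c + c ^ θ) * B * δ ^ α * Δ ^ θ * (c⁻¹ * J) := by
    refine (intervalIntegral.norm_integral_le_of_norm_le (g := fun s =>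
      256 * (c + c ^ θ) * B * δ ^ α * Δ ^ θ * maj m (1 + α / 2) (c * (t - s))) ht ?_
      (hmajI.const_mul _)).trans ?_
    · filter_upwards [hne t] with s hst hs
      have hlt : s < t := lt_of_le_of_ne hs.2 hst
      have := full_bound (hFc s hs.1.le) (oExt_bound (hb s hs.1.le)) hB hγ0 (by linarith) hα0 hα1
        hθ0 hθ1 (hFH s hs.1.le) (v := c * (t - s)) (mul_pos hc0 (sub_pos.2 hlt)) hc0 hΔ0 hΔ1
        hδ0 hδ1 y
      rw [show c * (t - s) + c * Δ = c * (t + Δ - s) by ring] at this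
      exact this
    · rw [intervalIntegral.integral_const_mul]
      refine mul_le_mul_of_nonneg_left ?_ (by positivity)
      have e1 := intervalIntegral.integral_comp_sub_left (a := 0) (b := t)
        (fun u => maj m (1 + α / 2) (c * u)) t
      rw [e1, intervalIntegral.integral_comp_mul_left _ hc0.ne', sub_self, sub_zero, mul_zero,
        smul_eq_mul, intervalIntegral.integral_of_le (by positivity)]
      refine mul_le_mul_of_nonneg_left ?_ (by positivity)
      refine setIntegral_mono_set hI ?_ (Set.Ioc_subset_Ioi_self.eventuallyLE)
      exact (ae_restrict_iff' measurableSet_Ioi).2 (.of_forall fun v hv => maj_nonneg _ _ hv)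
  have hrI : IntervalIntegrable (fun s => (c * (t + Δ - s)) ^ (-(e / 2))) volume t (t + Δ) := by
    have h1 : IntervalIntegrable (fun u : ℝ => u ^ (-(e / 2))) volume 0 (c * Δ) :=
      intervalIntegral.intervalIntegrable_rpow' (by linarith)
    have h2 := (h1.comp_mul_left (c := c)).comp_sub_left (t + Δ)
    rw [mul_div_cancel_left₀ _ hc0.ne'] at h2
    simp only [zero_div, sub_zero, add_sub_cancel_right] at h2
    exact h2.symm
  have p2 : ‖∫ s in t..(t + Δ), (hP (c * (t + Δ - s)) (oExt (g s)) (y + δ) -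
        hP (c * (t + Δ - s)) (oExt (g s)) y)‖ ≤
      4 * B * δ ^ α * (2 * (c ^ (-(e / 2)) * Δ ^ θ)) := by
    refine (intervalIntegral.norm_integral_le_of_norm_le (g := fun s =>
      4 * B * δ ^ α * (c * (t + Δ - s)) ^ (-(e / 2))) (by linarith) ?_
      (hrI.const_mul _)).trans ?_
    · filter_upwards [hne (t + Δ)] with s hst hs
      have hlt : s < t + Δ := lt_of_le_of_ne hs.2 hst
      have hs0 : 0 ≤ s := ht.trans hs.1.le
      have := sp_bound (hFc s hs0) (oExt_bound (hb s hs0)) (by positivity) hγ0 he0 he1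
        (by linarith) hea (hFH s hs0) (v := c * (t + Δ - s)) (mul_pos hc0 (sub_pos.2 hlt))
        hδ0 hδ1 y
      exact this.trans (le_of_eq (by ring))
    · rw [intervalIntegral.integral_const_mul]
      refine mul_le_mul_of_nonneg_left ?_ (by positivity)
      have e1 := intervalIntegral.integral_comp_sub_left (a := t) (b := t + Δ)
        (fun u => (c * u) ^ (-(e / 2))) (t + Δ)
      rw [e1, sub_self, add_sub_cancel_left]
      have e2 : ∫ u in (0 : ℝ)..Δ, (c * u) ^ (-(e / 2)) =
          ∫ u in (0 : ℝ)..Δ, c ^ (-(e / 2)) * u ^ (-(e / 2)) := by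
        refine intervalIntegral.integral_congr fun u hu => ?_
        rw [Set.uIcc_of_le hΔ0.le] at hu
        exact Real.mul_rpow hc0.le hu.1
      rw [e2, intervalIntegral.integral_const_mul, integral_rpow (Or.inl (by linarith)),
        Real.zero_rpow (by linarith), sub_zero]
      have h3 : Δ ^ (-(e / 2) + 1) ≤ Δ ^ θ :=
        Real.rpow_le_rpow_of_exponent_ge hΔ0 hΔ1 (by linarith)
      have h4 : Δ ^ (-(e / 2) + 1) / (-(e / 2) + 1) ≤ 2 * Δ ^ θ := by
        rw [div_le_iff₀ (by linarith)]
        have : 0 ≤ Δ ^ θ := by positivity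
        nlinarith
      have h5 : 0 ≤ c ^ (-(e / 2)) := by positivity
      exact (mul_le_mul_of_nonneg_left h4 h5).trans (le_of_eq (by ring))
  rw [hdec]
  refine (abs_add_le _ _).trans ((add_le_add p1 p2).trans (le_of_eq ?_))
  ring
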